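/- Theorem 1, converse part for the regime P ≥ (K−M)/2. Under the PIR-with-private-side-information setup, with S = {1,…,M} and demand set 𝒫 = {M+1,…,M+P}, if P ≥ (K−M)/2 then the normalized total download satisfies (1/(P·L))·∑_{n=1}^{N} H(A_n^{S,𝒫}) ≥ 1 + (K−M−P)/(P·N). -/

import Mathlib

open scoped BigOperators

/-- Probability that random variable `X` takes the value `x`, under the
probability mass function `p` on the finite sample space `Ω`. -/
noncomputable def pr {Ω : Type} [Fintype Ω] (p : Ω → ℝ) {α : Type} [DecidableEq α]
    (X : Ω → α) (x : α) : ℝ :=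
  ∑ ω ∈ Finset.univ.filter (fun ω => X ω = x), p ω

/-- Shannon entropy of `X` in base `b` (with the convention `0 * log 0 = 0`). -/
noncomputable def ent {Ω : Type} [Fintype Ω] (b : ℝ) (p : Ω → ℝ) {α : Type} [Fintype α]
    [DecidableEq α] (X : Ω → α) : ℝ :=
  -∑ x : α, pr p X x * Real.logb b (pr p X x)

/-- Conditional entropy `H(X ∣ Y) = H(X, Y) - H(Y)`, in base `b`. -/
noncomputable def condEnt {Ω : Type} [Fintype Ω] (b : ℝ) (p : Ω → ℝ) {α β : Type} [Fintype α]
    [DecidableEq α] [Fintype β] [DecidableEq β] (X : Ω → α) (Y : Ω → β) : ℝ :=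
  ent b p (fun ω => (X ω, Y ω)) - ent b p Y

/-- `X` is a deterministic function of `Y`. -/
def detFn {Ω α β : Type} (X : Ω → α) (Y : Ω → β) : Prop :=
  ∃ f : β → α, ∀ ω, X ω = f (Y ω)

/-- Admissible demand sets: subsets of `{1,…,K} \ S` of size `P`
(indices are `0`-based, and `S = {1,…,M}` corresponds to indices `< M`). -/
def demands (K M P : ℕ) : Finset (Finset (Fin K)) :=
  Finset.univ.filter (fun T => T.card = P ∧ ∀ i ∈ T, M ≤ i.val)

section Entropy

variable {Ω : Type} [Fintype Ω] {p : Ω → ℝ}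

lemma pr_nonneg {α : Type} [DecidableEq α] (hp : ∀ ω, 0 ≤ p ω) (X : Ω → α) (x : α) :
    0 ≤ pr p X x :=
  Finset.sum_nonneg fun ω _ => hp ω

lemma le_pr_apply {α : Type} [DecidableEq α] (hp : ∀ ω, 0 ≤ p ω) (X : Ω → α) (ω : Ω) :
    p ω ≤ pr p X (X ω) :=
  Finset.single_le_sum (f := p) (fun ω _ => hp ω) (by simp)

lemma sum_pr_prod_left {α γ : Type} [Fintype α] [DecidableEq α]
    [DecidableEq γ] (X : Ω → α) (Z : Ω → γ) (z : γ) :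
    ∑ x, pr p (fun ω => (X ω, Z ω)) (x, z) = pr p Z z := by
  unfold pr
  rw [← Finset.sum_fiberwise (Finset.univ.filter fun ω => Z ω = z) X p]
  refine Finset.sum_congr rfl fun x _ => Finset.sum_congr ?_ fun _ _ => rfl
  ext ω
  simp [and_comm]

variable {α β γ : Type} [Fintype α] [DecidableEq α] [Fintype β] [DecidableEq β]
  [Fintype γ] [DecidableEq γ]

lemma sum_pr_mul (X : Ω → α) (g : α → ℝ) :
    ∑ x, pr p X x * g x = ∑ ω, p ω * g (X ω) := by
  rw [← Finset.sum_fiberwise Finset.univ X (fun ω => p ω * g (X ω))]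
  refine Finset.sum_congr rfl fun x _ => ?_
  rw [pr, Finset.sum_mul]
  refine Finset.sum_congr rfl fun ω hω => ?_
  rw [(Finset.mem_filter.mp hω).2]

lemma sum_pr (X : Ω → α) : ∑ x, pr p X x = ∑ ω, p ω := by
  simpa using sum_pr_mul (p := p) X (fun _ => 1)

lemma ent_eq_expectation (b : ℝ) (X : Ω → α) :
    ent b p X = -∑ ω, p ω * Real.logb b (pr p X (X ω)) := by
  rw [ent, sum_pr_mul X (fun x => Real.logb b (pr p X x))]

/-- A variable which is determined by another one has smaller entropy. -/
lemma ent_le_of_factors {b : ℝ} (hb : 1 < b) (hp : ∀ ω, 0 ≤ p ω) {X : Ω → α} {Y : Ω → β}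
    (h : ∀ ω ω', Y ω = Y ω' → X ω = X ω') : ent b p X ≤ ent b p Y := by
  rw [ent_eq_expectation, ent_eq_expectation]
  refine neg_le_neg (Finset.sum_le_sum fun ω _ => ?_)
  rcases (hp ω).eq_or_lt with h0 | h0
  · simp [← h0]
  · refine mul_le_mul_of_nonneg_left (Real.logb_le_logb_of_le hb
      (h0.trans_le (le_pr_apply hp Y ω)) ?_) h0.le
    refine Finset.sum_le_sum_of_subset_of_nonneg (fun ω' hω' => ?_) fun ω _ _ => hp ω
    simp only [Finset.mem_filter, Finset.mem_univ, true_and] at hω' ⊢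
    exact h _ _ hω'

/-- Submodularity of entropy. -/
lemma ent_submodular {b : ℝ} (hb : 1 < b) (hp : ∀ ω, 0 ≤ p ω) (X : Ω → α) (Y : Ω → β)
    (Z : Ω → γ) :
    ent b p (fun ω => (X ω, Y ω, Z ω)) + ent b p Z
      ≤ ent b p (fun ω => (X ω, Z ω)) + ent b p (fun ω => (Y ω, Z ω)) := by
  have hlog : 0 < Real.log b := Real.log_pos hb
  set XZ := fun ω => (X ω, Z ω) with hXZ
  set YZ := fun ω => (Y ω, Z ω) with hYZ
  set V := fun ω => (X ω, Y ω, Z ω) with hV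
  let g : α × β × γ → ℝ := fun v =>
    pr p XZ (v.1, v.2.2) * pr p YZ (v.2.1, v.2.2) / (pr p V v * pr p Z v.2.2)
  have hpoint : ∀ ω, p ω * (Real.logb b (pr p XZ (XZ ω)) + Real.logb b (pr p YZ (YZ ω))
      - Real.logb b (pr p V (V ω)) - Real.logb b (pr p Z (Z ω))) * Real.log b
      ≤ p ω * g (V ω) - p ω := by
    intro ω
    rcases (hp ω).eq_or_lt with h0 | h0
    · simp [← h0]
    · have h1 := h0.trans_le (le_pr_apply hp XZ ω)
      have h2 := h0.trans_le (le_pr_apply hp YZ ω)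
      have h3 := h0.trans_le (le_pr_apply hp V ω)
      have h4 := h0.trans_le (le_pr_apply hp Z ω)
      have hg : g (V ω) = pr p XZ (XZ ω) * pr p YZ (YZ ω) / (pr p V (V ω) * pr p Z (Z ω)) := rfl
      have hle := Real.log_le_sub_one_of_pos (x := g (V ω)) (by rw [hg]; positivity)
      have hlg : Real.log (g (V ω)) = Real.log (pr p XZ (XZ ω)) + Real.log (pr p YZ (YZ ω))
          - Real.log (pr p V (V ω)) - Real.log (pr p Z (Z ω)) := by
        rw [hg, Real.log_div (by positivity) (by positivity), Real.log_mul h1.ne' h2.ne',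
          Real.log_mul h3.ne' h4.ne']
        ring
      have hm := mul_le_mul_of_nonneg_left hle h0.le
      rw [hlg] at hm
      simp only [Real.logb]
      calc _ = p ω * (Real.log (pr p XZ (XZ ω)) + Real.log (pr p YZ (YZ ω))
          - Real.log (pr p V (V ω)) - Real.log (pr p Z (Z ω))) := by field_simp
        _ ≤ _ := hm
        _ = _ := by ring
  have hmass : ∑ ω, p ω * g (V ω) ≤ ∑ ω, p ω := by
    rw [← sum_pr_mul V g, ← sum_pr Z]
    calc ∑ v, pr p V v * g v
        ≤ ∑ v : α × β × γ, pr p XZ (v.1, v.2.2) * pr p YZ (v.2.1, v.2.2) / pr p Z v.2.2 := by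
          refine Finset.sum_le_sum fun v _ => ?_
          have h1 := pr_nonneg hp XZ (v.1, v.2.2)
          have h2 := pr_nonneg hp YZ (v.2.1, v.2.2)
          have h4 := pr_nonneg hp Z v.2.2
          rcases (pr_nonneg hp V v).eq_or_lt with h3 | h3
          · rw [← h3, zero_mul]; positivity
          · refine le_of_eq ?_
            simp only [g]
            rw [← mul_div_assoc, mul_div_mul_left _ _ h3.ne']
      _ = ∑ z, ∑ x, ∑ y, pr p XZ (x, z) * pr p YZ (y, z) / pr p Z z := by
          simp only [Fintype.sum_prod_type]
          rw [Finset.sum_comm' (t' := Finset.univ) (s' := fun _ => Finset.univ) (by simp)]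
          rw [Finset.sum_comm]
          simp_rw [Finset.sum_comm (s := (Finset.univ : Finset β)) (t := (Finset.univ : Finset γ))]
          rw [Finset.sum_comm]
      _ = ∑ z, pr p Z z := by
          refine Finset.sum_congr rfl fun z _ => ?_
          simp_rw [← Finset.sum_div, ← Finset.mul_sum, ← Finset.sum_mul]
          rw [sum_pr_prod_left X Z z, sum_pr_prod_left Y Z z, mul_self_div_self]
  have hsum := Finset.sum_le_sum fun ω (_ : ω ∈ Finset.univ) => hpoint ω
  rw [← Finset.sum_mul, Finset.sum_sub_distrib] at hsum
  have hneg := nonpos_of_mul_nonpos_left (hsum.trans (sub_nonpos.mpr hmass)) hlog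
  simp only [mul_sub, mul_add, Finset.sum_sub_distrib, Finset.sum_add_distrib] at hneg
  simp only [ent_eq_expectation]
  linarith

lemma ent_prod_le_add {b : ℝ} (hb : 1 < b) (hp : ∀ ω, 0 ≤ p ω) (hp1 : ∑ ω, p ω = 1)
    (X : Ω → α) (Z : Ω → γ) :
    ent b p (fun ω => (X ω, Z ω)) ≤ ent b p X + ent b p Z := by
  have h := ent_submodular hb hp X Z (fun _ => ())
  have h0 : ent b p (fun _ : Ω => ()) = 0 := by simp [ent_eq_expectation, pr, hp1]
  have h1 : ent b p (fun ω => (X ω, Z ω)) ≤ ent b p (fun ω => (X ω, Z ω, ())) :=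
    ent_le_of_factors hb hp (by simp)
  have h2 : ent b p (fun ω => (X ω, ())) ≤ ent b p X := ent_le_of_factors hb hp (by simp)
  have h3 : ent b p (fun ω => (Z ω, ())) ≤ ent b p Z := ent_le_of_factors hb hp (by simp)
  linarith

lemma condEnt_le_ent {b : ℝ} (hb : 1 < b) (hp : ∀ ω, 0 ≤ p ω) (hp1 : ∑ ω, p ω = 1)
    (X : Ω → α) (Z : Ω → γ) : condEnt b p X Z ≤ ent b p X := by
  have := ent_prod_le_add hb hp hp1 X Z
  unfold condEnt
  linarith

/-- Subadditivity of conditional entropy for families of random variables. -/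
lemma condEnt_pi_le_sum {b : ℝ} (hb : 1 < b) (hp : ∀ ω, 0 ≤ p ω) {ι : Type} [Fintype ι]
    [DecidableEq ι] (X : ι → Ω → α) (Z : Ω → γ) :
    condEnt b p (fun ω i => X i ω) Z ≤ ∑ i, condEnt b p (X i) Z := by
  have key : ∀ s : Finset ι,
      condEnt b p (fun ω (i : ↥s) => X i ω) Z ≤ ∑ i ∈ s, condEnt b p (X i) Z := by
    intro s
    induction s using Finset.induction_on with
    | empty =>
      have : ent b p (fun ω => ((fun i : ↥(∅ : Finset ι) => X i ω), Z ω)) ≤ ent b p Z :=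
        ent_le_of_factors hb hp fun ω ω' h =>
          Prod.ext (funext fun i => absurd i.2 (Finset.notMem_empty _)) h
      rw [condEnt, Finset.sum_empty]
      linarith
    | insert a s ha ih =>
      have h1 := ent_submodular hb hp (X a) (fun ω (i : ↥s) => X i ω) Z
      have h2 : ent b p (fun ω => ((fun i : ↥(insert a s) => X i ω), Z ω))
          ≤ ent b p (fun ω => (X a ω, (fun i : ↥s => X i ω), Z ω)) := by
        refine ent_le_of_factors hb hp fun ω ω' h => ?_
        simp only [Prod.mk.injEq] at h ⊢
        refine ⟨funext fun i => ?_, h.2.2⟩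
        rcases Finset.mem_insert.mp i.2 with hi | hi
        · rw [hi]; exact h.1
        · exact congrFun h.2.1 ⟨i, hi⟩
      rw [Finset.sum_insert ha]
      simp only [condEnt] at ih ⊢
      linarith
  refine le_trans ?_ (key Finset.univ)
  have : ent b p (fun ω => ((fun i => X i ω), Z ω))
      ≤ ent b p (fun ω => ((fun i : ↥(Finset.univ : Finset ι) => X i ω), Z ω)) := by
    refine ent_le_of_factors hb hp fun ω ω' h => ?_
    simp only [Prod.mk.injEq] at h ⊢
    exact ⟨funext fun i => congrFun h.1 ⟨i, Finset.mem_univ i⟩, h.2⟩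
  unfold condEnt
  linarith

end Entropy

lemma card_filter_restrict_eq {ι V : Type} [Fintype ι] [DecidableEq ι] [Fintype V]
    [DecidableEq V] (T : Finset ι) (w : ↥T → V) :
    (Finset.univ.filter (fun v : ι → V => (fun i : ↥T => v i) = w)).card
      = Fintype.card V ^ (Fintype.card ι - T.card) := by
  have : Finset.univ.filter (fun v : ι → V => (fun i : ↥T => v i) = w)
      = Fintype.piFinset (fun i => if h : i ∈ T then {w ⟨i, h⟩} else Finset.univ) := by
    ext v
    simp only [Finset.mem_filter, Finset.mem_univ, true_and, Fintype.mem_piFinset, funext_iff,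
      Subtype.forall]
    refine forall_congr' fun i => ?_
    by_cases h : i ∈ T <;> simp [h]
  rw [this, Fintype.card_piFinset]
  have h2 : ∀ i, (if h : i ∈ T then ({w ⟨i, h⟩} : Finset V) else Finset.univ).card
      = if i ∈ Tᶜ then Fintype.card V else 1 := by
    intro i
    by_cases h : i ∈ T <;> simp [h]
  simp_rw [h2]
  rw [Finset.prod_ite_mem, Finset.univ_inter, Finset.prod_const, Finset.card_compl]

/-- Joint entropy of an auxiliary variable with a subfamily of i.i.d. uniform files independent
of it. -/
lemma ent_prod_uniform {Ω : Type} [Fintype Ω] {p : Ω → ℝ} (hp : ∀ ω, 0 ≤ p ω)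
    (hp1 : ∑ ω, p ω = 1) {F : Type} [Fintype F] [DecidableEq F] (hF : 1 < Fintype.card F)
    {κ : Type} [Fintype κ] [DecidableEq κ] {K L : ℕ} (W : Fin K → Ω → (Fin L → F)) (Q : Ω → κ)
    (hU : ∀ (w : Fin K → Fin L → F) (q : κ), pr p (fun ω => ((fun i => W i ω), Q ω)) (w, q)
      = ((Fintype.card F : ℝ) ^ (K * L))⁻¹ * pr p Q q) (T : Finset (Fin K)) :
    ent (Fintype.card F) p (fun ω => (Q ω, (fun i : ↥T => W i.val ω)))
      = ent (Fintype.card F) p Q + T.card * L := by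
  have hb : (1 : ℝ) < Fintype.card F := by exact_mod_cast hF
  have hb0 : (0 : ℝ) < Fintype.card F := by linarith
  have hT : T.card ≤ K := by simpa using T.card_le_univ
  have hmarg : ∀ q w, pr p (fun ω => (Q ω, (fun i : ↥T => W i.val ω))) (q, w)
      = ((Fintype.card F : ℝ) ^ (T.card * L))⁻¹ * pr p Q q := by
    intro q w
    have h1 : pr p (fun ω => (Q ω, (fun i : ↥T => W i.val ω))) (q, w)
        = ∑ v ∈ Finset.univ.filter (fun v : Fin K → Fin L → F => (fun i : ↥T => v i) = w),
          pr p (fun ω => ((fun i => W i ω), Q ω)) (v, q) := by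
      unfold pr
      rw [← Finset.sum_fiberwise_of_maps_to (g := fun ω i => W i ω)
        (t := Finset.univ.filter (fun v : Fin K → Fin L → F => (fun i : ↥T => v i) = w))]
      · refine Finset.sum_congr rfl fun v hv => Finset.sum_congr ?_ fun _ _ => rfl
        have hv' := (Finset.mem_filter.mp hv).2
        ext ω
        simp only [Finset.mem_filter, Finset.mem_univ, true_and, Prod.mk.injEq]
        constructor
        · rintro ⟨⟨h1, h2⟩, h3⟩
          exact ⟨h3, h1⟩
        · rintro ⟨h3, h1⟩
          refine ⟨⟨h1, ?_⟩, h3⟩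
          rw [← hv', ← h3]
      · intro ω hω
        simp only [Finset.mem_filter, Finset.mem_univ, true_and, Prod.mk.injEq] at hω ⊢
        exact hω.2
    rw [h1, Finset.sum_congr rfl fun v _ => hU v q, Finset.sum_const, card_filter_restrict_eq,
      nsmul_eq_mul, ← mul_assoc]
    congr 1
    obtain ⟨m, hm⟩ := Nat.exists_eq_add_of_le hT
    have hs : Fintype.card (Fin K) - T.card = m := by rw [Fintype.card_fin]; omega
    have hKL : K * L = T.card * L + L * m := by
      conv_lhs => rw [hm]
      ring
    rw [hs, Fintype.card_fun, Fintype.card_fin, hKL]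
    push_cast
    rw [← pow_mul, pow_add, mul_inv]
    field_simp
  rw [ent_eq_expectation, ent_eq_expectation]
  have hpt : ∀ ω, p ω * Real.logb (Fintype.card F)
        (pr p (fun ω => (Q ω, (fun i : ↥T => W i.val ω))) (Q ω, (fun i : ↥T => W i.val ω)))
      = p ω * Real.logb (Fintype.card F) (pr p Q (Q ω)) - p ω * (T.card * L) := by
    intro ω
    rcases (hp ω).eq_or_lt with h0 | h0
    · simp [← h0]
    · have h1 := h0.trans_le (le_pr_apply hp Q ω)
      rw [hmarg, Real.logb_mul (by positivity) h1.ne', Real.logb_inv, Real.logb_pow,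
        Real.logb_self_eq_one hb]
      push_cast
      ring
  rw [Finset.sum_congr rfl fun ω _ => hpt ω, Finset.sum_sub_distrib, ← Finset.sum_mul, hp1]
  ring

/-- Theorem 1 of the paper, converse part for the regime `P ≥ (K-M)/2`:
`(1/(P·L))·∑ₙ H(Aₙ^{S,𝒫}) ≥ 1 + (K-M-P)/(P·N)`. -/
theorem theorem1_converse_high_P
    (F : Type) [Field F] [Fintype F] [DecidableEq F]
    (QT AT : Type) [Fintype QT] [DecidableEq QT] [Fintype AT] [DecidableEq AT]
    (Ω : Type) [Fintype Ω]
    (p : Ω → ℝ) (hp0 : ∀ ω, 0 ≤ p ω) (hp1 : ∑ ω, p ω = 1)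
    (N K L M P : ℕ) (hN : 0 < N) (hMPK : M + P ≤ K)
    (W : Fin K → Ω → (Fin L → F))
    (Qu : ↥(demands K M P) → Fin N → Ω → QT)
    (A : ↥(demands K M P) → Fin N → Ω → AT)
    (Qall : Ω → (↥(demands K M P) → Fin N → QT))
    (hQall : Qall = fun ω d n => Qu d n ω)
    (S : Finset (Fin K)) (hS : S = Finset.univ.filter (fun i => i.val < M))
    (Pd : Finset (Fin K))
    (hPdDef : Pd = Finset.univ.filter (fun i => M ≤ i.val ∧ i.val < M + P))
    (hPd : Pd ∈ demands K M P)
    -- the files are i.i.d. uniform on `F^L` and independent of all the queries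
    (hUnif : ∀ (w : Fin K → Fin L → F) (q : ↥(demands K M P) → Fin N → QT),
      pr p (fun ω => ((fun i => W i ω), Qall ω)) (w, q)
        = ((Fintype.card F : ℝ) ^ (K * L))⁻¹ * pr p Qall q)
    -- each answer is a deterministic function of the library and the received query
    (hAns : ∀ (d : ↥(demands K M P)) (n : Fin N),
      detFn (A d n) (fun ω => ((fun i => W i ω), Qu d n ω)))
    -- decodability
    (hDec : ∀ d : ↥(demands K M P),
      detFn (fun ω => (fun i : ↥(d : Finset (Fin K)) => W i.val ω))
        (fun ω => ((fun n => A d n ω), Qall ω, (fun i : ↥S => W i.val ω))))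
    -- privacy/symmetry (i)
    (hSym : ∀ (n : Fin N) (d d' : ↥(demands K M P)) (T : Finset (Fin K)),
      condEnt (Fintype.card F) p (A d n)
          (fun ω => (Qall ω, (fun i : ↥T => W i.val ω)))
        = condEnt (Fintype.card F) p (A d' ⟨0, hN⟩)
          (fun ω => (Qall ω, (fun i : ↥T => W i.val ω))))
    -- privacy/symmetry (ii)
    (hMix : ∀ (n : Fin N) (d d' : ↥(demands K M P)),
      detFn (fun ω => (fun i : ↥(d : Finset (Fin K)) => W i.val ω))
        (fun ω => ((fun m : Fin N => if m = n then A d' n ω else A d m ω),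
          Qall ω, (fun i : ↥S => W i.val ω))))
    (hP : 0 < P) (hL : 0 < L)
    (hReg : ((K : ℝ) - M) / 2 ≤ P) :
    1 + ((K : ℝ) - M - P) / ((P : ℝ) * N)
      ≤ (1 / ((P : ℝ) * L)) * ∑ n : Fin N, ent (Fintype.card F) p (A ⟨Pd, hPd⟩ n) := by
  have hF : 1 < Fintype.card F := Fintype.one_lt_card
  have hb : (1 : ℝ) < Fintype.card F := by exact_mod_cast hF
  have hKR : K ≤ M + 2 * P := by
    have : (K : ℝ) ≤ M + 2 * P := by linarith
    exact_mod_cast this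
  have hU := ent_prod_uniform hp0 hp1 hF W Qall hUnif
  have hScard : S.card = M := by
    have : S = Finset.univ.filter (fun i : Fin K => i.val < M) := hS
    rw [this, Fin.card_filter_val_lt]
    omega
  have hPcard : Pd.card = P := (Finset.mem_filter.mp hPd).2.1
  have hdisj : Disjoint S Pd := by
    rw [Finset.disjoint_left, hS, hPdDef]
    intro i hi hi'
    simp only [Finset.mem_filter, Finset.mem_univ, true_and] at hi hi'
    omega
  -- a demand set containing every file outside the side information and `Pd`
  have hsub : (S ∪ Pd)ᶜ ⊆ Sᶜ := Finset.compl_subset_compl.mpr Finset.subset_union_left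
  have hUcard : (S ∪ Pd).card = M + P := by
    rw [Finset.card_union_of_disjoint hdisj, hScard, hPcard]
  obtain ⟨D, hD1, hD2, hD3⟩ := Finset.exists_subsuperset_card_eq hsub (n := P)
    (by rw [Finset.card_compl, Fintype.card_fin]; omega)
    (by rw [Finset.card_compl, Fintype.card_fin]; omega)
  have hD : D ∈ demands K M P := by
    refine Finset.mem_filter.mpr ⟨Finset.mem_univ _, hD3, fun i hi => ?_⟩
    have := hD2 hi
    simp only [hS, Finset.mem_compl, Finset.mem_filter, Finset.mem_univ, true_and] at this
    omega
  set b : ℝ := (Fintype.card F : ℝ) with hbdef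
  set Z : Ω → _ := fun ω => (Qall ω, (fun i : ↥S => W i.val ω)) with hZ
  set Z' : Ω → _ := fun ω => (Qall ω, (fun i : ↥(S ∪ Pd) => W i.val ω)) with hZ'
  have hZent : ent b p Z = ent b p Qall + M * L := by rw [hZ, hU S, hScard]
  have hZ'ent : ent b p Z' = ent b p Qall + (M + P) * L := by
    rw [hZ', hU, hUcard]; push_cast; ring
  -- the answers to the actual demand
  have hactual : condEnt b p (A ⟨Pd, hPd⟩ ⟨0, hN⟩) Z' + P * L
      ≤ ∑ n : Fin N, ent b p (A ⟨Pd, hPd⟩ n) := by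
    have h1 := condEnt_pi_le_sum hb hp0 (A ⟨Pd, hPd⟩) Z
    have h2 : ∑ n, condEnt b p (A ⟨Pd, hPd⟩ n) Z ≤ ∑ n, ent b p (A ⟨Pd, hPd⟩ n) :=
      Finset.sum_le_sum fun n _ => condEnt_le_ent hb hp0 hp1 _ _
    have h3 : ent b p (fun ω => (A ⟨Pd, hPd⟩ ⟨0, hN⟩ ω, Z' ω))
        ≤ ent b p (fun ω => ((fun n => A ⟨Pd, hPd⟩ n ω), Z ω)) := by
      obtain ⟨f, hf⟩ := hDec ⟨Pd, hPd⟩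
      refine ent_le_of_factors hb hp0 fun ω ω' h => ?_
      have hW := (hf ω).trans ((congrArg f h).trans (hf ω').symm)
      simp only [hZ, hZ', Prod.mk.injEq] at h ⊢
      refine ⟨congrFun h.1 _, h.2.1, funext fun i => ?_⟩
      rcases Finset.mem_union.mp i.2 with hi | hi
      · exact congrFun h.2.2 ⟨i, hi⟩
      · exact congrFun hW ⟨i, hi⟩
    simp only [condEnt] at h1 h2 ⊢
    linarith
  -- the answers to the demand `D`
  have hother : ((K : ℝ) - M - P) * L ≤ N * condEnt b p (A ⟨Pd, hPd⟩ ⟨0, hN⟩) Z' := by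
    have h1 := condEnt_pi_le_sum hb hp0 (A ⟨D, hD⟩) Z'
    have h2 : ∑ n, condEnt b p (A ⟨D, hD⟩ n) Z'
        = N * condEnt b p (A ⟨Pd, hPd⟩ ⟨0, hN⟩) Z' := by
      rw [Finset.sum_congr rfl fun n _ => hSym n ⟨D, hD⟩ ⟨Pd, hPd⟩ (S ∪ Pd)]
      simp [hZ']
    have h3 : ent b p (fun ω => (Qall ω, (fun i : ↥(Finset.univ : Finset (Fin K)) => W i.val ω)))
        ≤ ent b p (fun ω => ((fun n => A ⟨D, hD⟩ n ω), Z' ω)) := by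
      obtain ⟨f, hf⟩ := hDec ⟨D, hD⟩
      refine ent_le_of_factors hb hp0 fun ω ω' h => ?_
      simp only [hZ', Prod.mk.injEq] at h ⊢
      have hW := (hf ω).trans ((congrArg f (Prod.ext h.1 (Prod.ext h.2.1
        (funext fun i => congrFun h.2.2 ⟨i, Finset.mem_union_left _ i.2⟩)))).trans (hf ω').symm)
      refine ⟨h.2.1, funext fun i => ?_⟩
      by_cases hi : i.val ∈ S ∪ Pd
      · exact congrFun h.2.2 ⟨i, hi⟩
      · exact congrFun hW ⟨i, hD1 (Finset.mem_compl.mpr hi)⟩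
    rw [hU, Finset.card_univ, Fintype.card_fin] at h3
    rw [h2] at h1
    simp only [condEnt] at h1 ⊢
    linarith
  have hP' : (0 : ℝ) < P := by exact_mod_cast hP
  have hL' : (0 : ℝ) < L := by exact_mod_cast hL
  have hN' : (0 : ℝ) < N := by exact_mod_cast hN
  have hdiv : ((K : ℝ) - M - P) * L / N ≤ condEnt b p (A ⟨Pd, hPd⟩ ⟨0, hN⟩) Z' := by
    rw [div_le_iff₀ hN']
    linarith
  calc 1 + ((K : ℝ) - M - P) / ((P : ℝ) * N)
      = (1 / ((P : ℝ) * L)) * (((K : ℝ) - M - P) * L / N + P * L) := by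
        field_simp
        ring
    _ ≤ _ := mul_le_mul_of_nonneg_left (by linarith) (by positivity)
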